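/- arXiv:1902.09956 — 2 statements merged into one kernel-verified Lean document; each statement's English description precedes it below -/
import Mathlib

section
/- There exists a constant C > 0 such that for all squarefree integers h ≥ 1 and all real x ≥ 1, z ≥ 1, one has |∑_{n ≤ x, h | n} μ(n)²·M(n, z)² − x·T(z; h)| ≤ C·z·√x. -/
open Finset MeasureTheory Filter

/-- `M(n, z) := ∑_{d ∣ n, d ≤ z} μ(d)`. -/
noncomputable def mobM (n : ℕ) (z : ℝ) : ℤ :=
  ∑ d ∈ n.divisors.filter (fun d : ℕ => (d : ℝ) ≤ z), ArithmeticFunction.moebius d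

/-- `S(x, z) := ∑_{n ≤ x} M(n, z)²`. -/
noncomputable def Ssum (x z : ℝ) : ℝ :=
  ∑ n ∈ Finset.Icc 1 ⌊x⌋₊, ((mobM n z : ℝ)) ^ 2

/-- `S(z) := ∑_{m, n ≤ z} μ(m) μ(n) / [m, n]`. -/
noncomputable def Sz (z : ℝ) : ℝ :=
  ∑ m ∈ Finset.Icc 1 ⌊z⌋₊, ∑ n ∈ Finset.Icc 1 ⌊z⌋₊,
    ((ArithmeticFunction.moebius m : ℝ) * (ArithmeticFunction.moebius n : ℝ)) / (Nat.lcm m n : ℝ)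

/-- `f(n; iτ) := ∏_{p ∣ n} |1 - p^{-iτ}|²`. -/
noncomputable def fI (n : ℕ) (τ : ℝ) : ℝ :=
  ∏ p ∈ n.primeFactors, ‖(1 : ℂ) - (p : ℂ) ^ (-(τ * Complex.I))‖ ^ 2

/-- `f(n; s) := ∏_{p ∣ n} |1 - p^{-s}|²` for complex `s`. -/
noncomputable def fC (n : ℕ) (s : ℂ) : ℝ :=
  ∏ p ∈ n.primeFactors, ‖(1 : ℂ) - (p : ℂ) ^ (-s)‖ ^ 2

/-- The constant `L`. -/
noncomputable def Lconst : ℝ :=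
  (1 / (2 * Real.pi)) *
    ∫ τ : ℝ,
      (∏' p : Nat.Primes,
        (1 - 1 / ((p : ℕ) : ℝ)) * (1 + (fI (p : ℕ) τ - 1) / ((p : ℕ) : ℝ))) / τ ^ 2

/-- `𝓛(y) := exp{(log y)^{3/5} / (log log y)^{1/5}}`. -/
noncomputable def curlyL (y : ℝ) : ℝ :=
  Real.exp ((Real.log y) ^ ((3 : ℝ) / 5) / (Real.log (Real.log y)) ^ ((1 : ℝ) / 5))

/-- `ψ(n) := ∏_{p ∣ n} (p + 1)`. -/
def psi (n : ℕ) : ℕ := ∏ p ∈ n.primeFactors, (p + 1)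

/-- `ψ_m(n) := ∏_{p ∣ n, p ∤ m} (p + 1)`. -/
def psiM (m n : ℕ) : ℕ := ∏ p ∈ n.primeFactors.filter (fun p : ℕ => ¬ p ∣ m), (p + 1)

/-- `r(n) := ∏_{p ∣ n} (1 + 2/√p)`. -/
noncomputable def rfun (n : ℕ) : ℝ := ∏ p ∈ n.primeFactors, (1 + 2 / Real.sqrt p)

/-- `k(n)`, the squarefree kernel of `n`. -/
def ker (n : ℕ) : ℕ := ∏ p ∈ n.primeFactors, p

/-- `T(y; m) := (6/π²) ∑_{d, t ≤ y} μ(d) μ(t) / ψ([d, t, m])`. -/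
noncomputable def T (y : ℝ) (m : ℕ) : ℝ :=
  (6 / Real.pi ^ 2) *
    ∑ d ∈ Finset.Icc 1 ⌊y⌋₊, ∑ t ∈ Finset.Icc 1 ⌊y⌋₊,
      ((ArithmeticFunction.moebius d : ℝ) * (ArithmeticFunction.moebius t : ℝ)) /
        (psi (Nat.lcm (Nat.lcm d t) m) : ℝ)

/-- The constant `L(m)`. -/
noncomputable def Lm (m : ℕ) : ℝ :=
  ((Nat.totient m : ℝ) ^ 2 / (2 * Real.pi * (m : ℝ) ^ 2 * (ker m : ℝ))) *
    ∫ τ : ℝ,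
      (fI m τ *
        ∏' p : {p : Nat.Primes // ¬ ((p : ℕ) ∣ m)},
          (1 - 1 / ((p.1 : ℕ) : ℝ)) ^ 2 * (1 + fI (p.1 : ℕ) τ / ((p.1 : ℕ) : ℝ))) / τ ^ 2

/-- `B := ∏_p (1 - (3p + 1)/(p (p + 1)²))`. -/
noncomputable def Bconst : ℝ :=
  ∏' p : Nat.Primes,
    (1 - (3 * ((p : ℕ) : ℝ) + 1) / (((p : ℕ) : ℝ) * (((p : ℕ) : ℝ) + 1) ^ 2))

/-- `α(n) := ∏_{p ∣ n} (1 - p/(p² + 3p + 1))`. -/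
noncomputable def alpha (n : ℕ) : ℝ :=
  ∏ p ∈ n.primeFactors, (1 - (p : ℝ) / ((p : ℝ) ^ 2 + 3 * (p : ℝ) + 1))

open ArithmeticFunction (moebius)

/-- Reindexing a sum over the multiples of `g` up to `K`. -/
theorem sum_filter_dvd_Icc {g : ℕ} (hg : 0 < g) (K : ℕ) (f : ℕ → ℝ) :
    ∑ e ∈ (Icc 1 K).filter (fun e => g ∣ e), f e = ∑ k ∈ Icc 1 (K / g), f (g * k) := by
  refine Finset.sum_bij' (fun e _ => e / g) (fun k _ => g * k) ?_ ?_ ?_ ?_ ?_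
  · intro e he
    simp only [mem_filter, mem_Icc] at he ⊢
    exact ⟨Nat.div_pos (Nat.le_of_dvd (by lia) he.2) hg, Nat.div_le_div_right he.1.2⟩
  · intro k hk
    simp only [mem_filter, mem_Icc] at hk ⊢
    refine ⟨⟨Nat.mul_pos hg hk.1, ?_⟩, dvd_mul_right _ _⟩
    rw [mul_comm]
    exact (Nat.le_div_iff_mul_le hg).1 hk.2
  · intro e he
    exact Nat.mul_div_cancel' (mem_filter.1 he).2
  · intro k _
    exact Nat.mul_div_cancel_left k hg
  · intro e he
    rw [Nat.mul_div_cancel' (mem_filter.1 he).2]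

theorem sum_one_div_sqrt_le (n : ℕ) : ∑ k ∈ Icc 1 n, 1 / √(k : ℝ) ≤ 2 * √(n : ℝ) := by
  induction n with
  | zero => simp
  | succ n ih =>
    rw [Finset.sum_Icc_succ_top (by lia)]
    have hb : 0 < √((n + 1 : ℕ) : ℝ) := Real.sqrt_pos.2 (by positivity)
    have ha : 0 ≤ √(n : ℝ) := Real.sqrt_nonneg _
    have h1 : √((n + 1 : ℕ) : ℝ) ^ 2 = n + 1 := by
      rw [Real.sq_sqrt (by positivity)]; push_cast; ring
    have h2 : √(n : ℝ) ^ 2 = n := Real.sq_sqrt (by positivity)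
    have h3 : 1 / √((n + 1 : ℕ) : ℝ) ≤ 2 * √((n + 1 : ℕ) : ℝ) - 2 * √(n : ℝ) := by
      rw [div_le_iff₀ hb]
      nlinarith [sq_nonneg (√((n + 1 : ℕ) : ℝ) - √(n : ℝ))]
    linarith

theorem sum_min_one_div_sq_le {Y : ℝ} (hY : 0 < Y) (K : ℕ) :
    ∑ k ∈ Icc 1 K, min 1 (Y / (k : ℝ) ^ 2) ≤ 4 * √Y := by
  set s := √Y with hs
  have hs0 : 0 < s := Real.sqrt_pos.2 hY
  have hsY : Y = s ^ 2 := (Real.sq_sqrt hY.le).symm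
  suffices h : ∑ k ∈ Icc 1 K, min 1 (Y / (k : ℝ) ^ 2) ≤ 4 * s - 4 * s ^ 2 / (s + K) by
    have : 0 ≤ 4 * s ^ 2 / (s + K) := by positivity
    linarith
  induction K with
  | zero => simp; field_simp; simp
  | succ n ih =>
    rw [Finset.sum_Icc_succ_top (by lia)]
    have key : min 1 (Y / ((n + 1 : ℕ) : ℝ) ^ 2) ≤
        4 * s ^ 2 / (s + n) - 4 * s ^ 2 / (s + (n + 1 : ℕ)) := by
      push_cast
      have hn : (0 : ℝ) ≤ n := n.cast_nonneg
      have e1 : 4 * s ^ 2 / (s + n) - 4 * s ^ 2 / (s + (n + 1)) =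
          4 * s ^ 2 / ((s + n) * (s + (n + 1))) := by
        field_simp; ring
      rw [e1, hsY]
      rcases le_total s (n + 1) with h | h
      · refine (min_le_right _ _).trans ?_
        rw [div_le_div_iff₀ (by positivity) (by positivity)]
        have : (s + n) * (s + (n + 1)) ≤ 4 * ((n : ℝ) + 1) ^ 2 := by nlinarith
        nlinarith [sq_nonneg s]
      · refine (min_le_left _ _).trans ?_
        rw [le_div_iff₀ (by positivity)]
        nlinarith
    linarith

/-- Products over finite sets of numbers of a function that is at most one from `N` on. -/
theorem prod_le_pow_of_le {f : ℕ → ℝ} {B : ℝ} {N : ℕ} (h0 : ∀ n, 0 ≤ f n) (hB : 1 ≤ B)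
    (hfB : ∀ n, f n ≤ B) (hf1 : ∀ n, N ≤ n → f n ≤ 1) (s : Finset ℕ) :
    ∏ p ∈ s, f p ≤ B ^ N := by
  calc ∏ p ∈ s, f p ≤ ∏ p ∈ s, (if p < N then B else 1) := by
        refine Finset.prod_le_prod (fun p _ => h0 p) fun p _ => ?_
        split_ifs with h
        · exact hfB p
        · exact hf1 p (by lia)
    _ = B ^ (s.filter (fun p => p < N)).card := by
        rw [Finset.prod_ite, Finset.prod_const, Finset.prod_const_one, mul_one]
    _ ≤ B ^ N := by
        refine pow_le_pow_right₀ hB ?_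
        calc _ ≤ (range N).card := Finset.card_le_card (fun p hp => by simp_all)
          _ = N := card_range N

theorem squarefree_lcm {a b : ℕ} (ha : Squarefree a) (hb : Squarefree b) :
    Squarefree (Nat.lcm a b) := by
  have h := Nat.lcm_ne_zero ha.ne_zero hb.ne_zero
  rw [Nat.squarefree_iff_factorization_le_one h]
  intro p
  rw [Nat.factorization_lcm ha.ne_zero hb.ne_zero, Finsupp.sup_apply]
  exact sup_le (ha.natFactorization_le_one p) (hb.natFactorization_le_one p)

theorem sq_dvd_sq_mul_squarefree_iff {a b e : ℕ} (ha : Squarefree a) (hb : b ≠ 0) :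
    e ^ 2 ∣ b ^ 2 * a ↔ e ∣ b := by
  refine ⟨fun h => ?_, fun h => (pow_dvd_pow_of_dvd h 2).mul_right a⟩
  have hba : b ^ 2 * a ≠ 0 := mul_ne_zero (pow_ne_zero 2 hb) ha.ne_zero
  have he : e ≠ 0 := by
    rintro rfl
    simp [hb, ha.ne_zero] at h
  rw [← Nat.factorization_le_iff_dvd (pow_ne_zero 2 he) hba] at h
  rw [← Nat.factorization_le_iff_dvd he hb]
  intro p
  have h1 := h p
  have h2 := ha.natFactorization_le_one p
  rw [Nat.factorization_mul (pow_ne_zero 2 hb) ha.ne_zero] at h1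
  simp only [Nat.factorization_pow, Finsupp.add_apply, Finsupp.smul_apply, smul_eq_mul] at h1
  lia

theorem moebius_sq_eq_sum {n N : ℕ} (hn : n ≠ 0) (hN : n ≤ N) :
    (moebius n : ℝ) ^ 2 = ∑ e ∈ (Icc 1 N).filter (fun e => e ^ 2 ∣ n), (moebius e : ℝ) := by
  obtain ⟨a, b, -, hb, hab, ha⟩ := Nat.sq_mul_squarefree_of_pos (Nat.pos_of_ne_zero hn)
  have hset : (Icc 1 N).filter (fun e => e ^ 2 ∣ n) = b.divisors := by
    ext e
    simp only [mem_filter, mem_Icc, Nat.mem_divisors]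
    rw [← hab, sq_dvd_sq_mul_squarefree_iff ha hb.ne']
    constructor
    · exact fun h => ⟨h.2, hb.ne'⟩
    · refine fun h => ⟨⟨Nat.pos_of_dvd_of_pos h.1 hb, ?_⟩, h.1⟩
      have h1 := Nat.le_of_dvd hb h.1
      have h2 : b ≤ n := Nat.le_of_dvd (Nat.pos_of_ne_zero hn)
        (hab ▸ (dvd_pow_self b two_ne_zero).mul_right a)
      lia
  rw [hset]
  have h1 : ∑ e ∈ b.divisors, (moebius e : ℝ) = if b = 1 then 1 else 0 := by
    have h := congrArg (fun F : ArithmeticFunction ℤ => F b) ArithmeticFunction.coe_zeta_mul_moebius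
    simp only [ArithmeticFunction.coe_zeta_mul_apply, ArithmeticFunction.one_apply] at h
    exact_mod_cast h
  rw [h1]
  have h2 : (moebius n) ^ 2 = if Squarefree n then 1 else 0 := ArithmeticFunction.moebius_sq
  have h3 : Squarefree n ↔ b = 1 := by
    constructor
    · intro h
      have := h b ⟨a, by rw [← hab]; ring⟩
      exact Nat.isUnit_iff.1 this
    · rintro rfl
      rwa [← hab, one_pow, one_mul]
  simp only [h3] at h2
  exact_mod_cast h2

theorem sum_moebius_sq_dvd_eq (N m : ℕ) :
    ∑ n ∈ (Icc 1 N).filter (fun n => m ∣ n), (moebius n : ℝ) ^ 2 =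
      ∑ e ∈ Icc 1 N, (moebius e : ℝ) * ((N / Nat.lcm m (e ^ 2) : ℕ) : ℝ) := by
  calc _ = ∑ n ∈ (Icc 1 N).filter (fun n => m ∣ n),
        ∑ e ∈ Icc 1 N, if e ^ 2 ∣ n then (moebius e : ℝ) else 0 := by
        refine Finset.sum_congr rfl fun n hn => ?_
        simp only [mem_filter, mem_Icc] at hn
        rw [moebius_sq_eq_sum (by lia) hn.1.2, Finset.sum_filter]
    _ = ∑ e ∈ Icc 1 N, ∑ n ∈ (Icc 1 N).filter (fun n => Nat.lcm m (e ^ 2) ∣ n),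
        (moebius e : ℝ) := by
        rw [Finset.sum_comm]
        refine Finset.sum_congr rfl fun e _ => ?_
        rw [← Finset.sum_filter, Finset.filter_filter]
        simp only [Nat.lcm_dvd_iff]
    _ = _ := by
        refine Finset.sum_congr rfl fun e _ => ?_
        rw [Finset.sum_const, nsmul_eq_mul, mul_comm]
        congr 2
        exact Nat.Ioc_filter_dvd_card_eq_div N _

theorem hasSum_moebius_mul_gcd {m : ℕ} (hm : Squarefree m) :
    HasSum (fun e : ℕ => (moebius e : ℝ) * (Nat.gcd m e : ℝ) / (e : ℝ) ^ 2)
      (6 / Real.pi ^ 2 * (m / psi m)) := by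
  have hm0 := hm.ne_zero
  set f : ℕ → ℝ := fun e => (moebius e : ℝ) * (Nat.gcd m e : ℝ) / (e : ℝ) ^ 2 with hf
  have hsum : Summable (fun e => ‖f e‖) := by
    refine Summable.of_nonneg_of_le (fun _ => norm_nonneg _) (fun e => ?_)
      (hasSum_zeta_two.summable.mul_left (m : ℝ))
    rw [hf, norm_div, norm_mul, Real.norm_eq_abs, Real.norm_eq_abs, Real.norm_eq_abs,
      abs_of_nonneg (sq_nonneg (e : ℝ)), Nat.abs_cast, mul_one_div]
    gcongr
    have h1 : |(moebius e : ℝ)| ≤ 1 := by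
      exact_mod_cast ArithmeticFunction.abs_moebius_le_one (n := e)
    have h2 : (Nat.gcd m e : ℝ) ≤ m := by
      exact_mod_cast Nat.gcd_le_left e (Nat.pos_of_ne_zero hm0)
    calc _ ≤ 1 * (m : ℝ) := by gcongr
      _ = m := one_mul _
  have hprod := EulerProduct.eulerProduct_hasProd (f := f) (by simp [hf])
    (fun {a b} hab => by
      simp only [hf]
      rw [ArithmeticFunction.isMultiplicative_moebius.map_mul_of_coprime hab,
        hab.gcd_mul m]
      push_cast
      ring) hsum (by simp [hf])
  let g : ℕ →*₀ ℝ :=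
    { toFun := fun n => 1 / (n : ℝ) ^ 2
      map_zero' := by simp
      map_one' := by simp
      map_mul' := fun a b => by push_cast; rw [mul_pow, one_div_mul_one_div] }
  have hg := EulerProduct.eulerProduct_completely_multiplicative_hasProd (f := g)
    (hasSum_zeta_two.summable.norm)
  have hgsum : ∑' n, g n = Real.pi ^ 2 / 6 := hasSum_zeta_two.tsum_eq
  rw [hgsum] at hg
  have hmul := hprod.mul hg
  have hloc : (fun p : Nat.Primes => (∑' e, f ((p : ℕ) ^ e)) * (1 - g p)⁻¹) =
      fun p : Nat.Primes => if (p : ℕ) ∈ m.primeFactors then (p : ℝ) / (p + 1) else 1 := by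
    funext p
    have hp := p.2
    have hp1 : (1 : ℝ) < p := by exact_mod_cast hp.one_lt
    have h1 : ∑' e, f ((p : ℕ) ^ e) = 1 - (Nat.gcd m p : ℝ) / (p : ℝ) ^ 2 := by
      rw [tsum_eq_sum (s := range 2)]
      · simp [Finset.sum_range_succ, hf, ArithmeticFunction.moebius_apply_prime hp]
        ring
      · intro k hk
        have hk2 : 2 ≤ k := by simpa [Nat.succ_le_iff] using hk
        have : moebius ((p : ℕ) ^ k) = 0 := by
          rw [ArithmeticFunction.moebius_apply_prime_pow hp (by lia), if_neg (by lia)]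
        simp [hf, this]
    have hgp : g p = 1 / (p : ℝ) ^ 2 := rfl
    have hp2 : (p : ℝ) ^ 2 - 1 ≠ 0 := by nlinarith
    have hp3 : (p : ℝ) - 1 ≠ 0 := by linarith
    rw [h1, hgp]
    by_cases hpm : (p : ℕ) ∣ m
    · rw [Nat.gcd_eq_right hpm, if_pos (Nat.mem_primeFactors.2 ⟨hp, hpm, hm0⟩)]
      have : 1 - 1 / (p : ℝ) ^ 2 = (p - 1) * (p + 1) / p ^ 2 := by field_simp; ring
      rw [this]
      field_simp
    · rw [(Nat.coprime_comm.1 ((Nat.Prime.coprime_iff_not_dvd hp).2 hpm)).gcd_eq_one,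
        if_neg (fun h => hpm (Nat.dvd_of_mem_primeFactors h)), Nat.cast_one]
      refine mul_inv_cancel₀ ?_
      have : 1 - 1 / (p : ℝ) ^ 2 = ((p : ℝ) ^ 2 - 1) / p ^ 2 := by field_simp
      rw [this]
      exact div_ne_zero hp2 (by positivity)
  rw [hloc] at hmul
  have hfin : HasProd
      (fun p : Nat.Primes => if (p : ℕ) ∈ m.primeFactors then (p : ℝ) / (p + 1) else 1)
      (m / psi m) := by
    have h1 : HasProd (fun p : ℕ => if p ∈ m.primeFactors then (p : ℝ) / (p + 1) else 1)
        (∏ p ∈ m.primeFactors, if p ∈ m.primeFactors then (p : ℝ) / (p + 1) else 1) :=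
      hasProd_prod_of_ne_finset_one fun p hp => if_neg hp
    have h2 : (∏ p ∈ m.primeFactors, if p ∈ m.primeFactors then (p : ℝ) / (p + 1) else 1) =
        m / psi m := by
      rw [Finset.prod_congr rfl (fun p hp => if_pos hp), Finset.prod_div_distrib]
      congr 1
      · rw [← Nat.cast_prod, Nat.prod_primeFactors_of_squarefree hm]
      · simp [psi]
    rw [h2] at h1
    have hsupp : ∀ p ∉ Set.range (fun p : Nat.Primes => (p : ℕ)),
        (if p ∈ m.primeFactors then (p : ℝ) / (p + 1) else 1) = 1 :=
      fun p hp => if_neg fun h => hp ⟨⟨p, Nat.prime_of_mem_primeFactors h⟩, rfl⟩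
    exact (Function.Injective.hasProd_iff Subtype.val_injective hsupp).2 h1
  have huniq := hmul.unique hfin
  have hval : ∑' n, f n = 6 / Real.pi ^ 2 * (m / psi m) := by
    rw [← huniq]
    have := Real.pi_ne_zero
    field_simp
  rw [← hval]
  exact hsum.of_norm.hasSum

/-- `∏_{p ∣ n} (1 + 1/√p)`. -/
noncomputable def sqrtProd (n : ℕ) : ℝ := ∏ p ∈ n.primeFactors, (1 + 1 / √(p : ℝ))

/-- `∏_{p ∣ n} (1/√p + 1/p)`. -/
noncomputable def errWeight (n : ℕ) : ℝ := ∏ p ∈ n.primeFactors, (1 / √(p : ℝ) + 1 / (p : ℝ))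

theorem errWeight_nonneg (n : ℕ) : 0 ≤ errWeight n :=
  Finset.prod_nonneg fun _ _ => by positivity

theorem one_le_sqrtProd (n : ℕ) : 1 ≤ sqrtProd n := by
  refine Finset.prod_induction _ (fun y : ℝ => 1 ≤ y)
    (fun _ _ ha hb => one_le_mul_of_one_le_of_one_le ha hb) le_rfl fun p _ => ?_
  exact le_add_of_nonneg_right (by positivity)

theorem sqrtProd_eq_sum_divisors {m : ℕ} (hm : Squarefree m) :
    sqrtProd m = ∑ k ∈ m.divisors, 1 / √(k : ℝ) := by
  let f : ArithmeticFunction ℝ := ⟨fun k => 1 / √(k : ℝ), by simp⟩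
  have hf : f.IsMultiplicative := by
    refine ⟨by simp [f], fun {a b} _ => ?_⟩
    simp only [f, ArithmeticFunction.coe_mk]
    rw [Nat.cast_mul, Real.sqrt_mul (Nat.cast_nonneg a), one_div_mul_one_div]
  exact hf.prodPrimeFactors_one_add_of_squarefree hm

theorem errWeight_eq_div {m : ℕ} (hm : Squarefree m) :
    errWeight m = sqrtProd m / √(m : ℝ) := by
  have h1 : √(m : ℝ) = ∏ p ∈ m.primeFactors, √(p : ℝ) := by
    rw [← Real.sqrt_prod _ (fun p _ => Nat.cast_nonneg p), ← Nat.cast_prod,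
      Nat.prod_primeFactors_of_squarefree hm]
  rw [h1, sqrtProd, errWeight, ← Finset.prod_div_distrib]
  refine Finset.prod_congr rfl fun p _ => ?_
  rw [add_div, div_div, Real.mul_self_sqrt (Nat.cast_nonneg p)]

theorem abs_floor_div_sub_div_le {x : ℝ} (hx : 0 ≤ x) (L : ℕ) :
    |((⌊x⌋₊ / L : ℕ) : ℝ) - x / L| ≤ min 1 (x / L) := by
  have h0 : 0 ≤ x / L := by positivity
  rw [← Nat.floor_div_natCast, abs_sub_comm,
    abs_of_nonneg (sub_nonneg.2 (Nat.floor_le h0))]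
  refine le_min ?_ ?_
  · linarith [Nat.lt_floor_add_one (x / L)]
  · linarith [Nat.cast_nonneg (α := ℝ) ⌊x / L⌋₊]

theorem div_mul_gcd_div_sq {m : ℕ} (hm : Squarefree m) (x : ℝ) (e : ℕ) :
    x / m * ((Nat.gcd m e : ℝ) / (e : ℝ) ^ 2) = x / (Nat.lcm m (e ^ 2) : ℕ) := by
  rcases eq_or_ne e 0 with rfl | he
  · simp
  have hgcd : Nat.gcd m (e ^ 2) = Nat.gcd m e := by
    refine Nat.dvd_antisymm (Nat.dvd_gcd (Nat.gcd_dvd_left _ _) ?_)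
      (Nat.gcd_dvd_gcd_of_dvd_right m (dvd_pow_self e two_ne_zero))
    exact ((hm.squarefree_of_dvd (Nat.gcd_dvd_left m (e ^ 2))).dvd_pow_iff_dvd
      two_ne_zero).1 (Nat.gcd_dvd_right m (e ^ 2))
  have h1 : (Nat.gcd m e : ℝ) * (Nat.lcm m (e ^ 2) : ℕ) = m * (e : ℝ) ^ 2 := by
    have := Nat.gcd_mul_lcm m (e ^ 2)
    rw [hgcd] at this
    exact_mod_cast this
  have hm0 : (m : ℝ) ≠ 0 := by exact_mod_cast hm.ne_zero
  have he0 : (e : ℝ) ≠ 0 := by exact_mod_cast he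
  have hL : ((Nat.lcm m (e ^ 2) : ℕ) : ℝ) ≠ 0 := by
    exact_mod_cast Nat.lcm_ne_zero hm.ne_zero (pow_ne_zero 2 he)
  rw [div_mul_div_comm, div_eq_div_iff (by positivity) hL, ← h1]
  ring

/-- A bound for the `e`-th error term by a sum over the divisors of `m`. -/
theorem min_one_div_lcm_le {m e : ℕ} (hm : Squarefree m) (he : e ≠ 0) {x : ℝ} (hx : 0 ≤ x) :
    min 1 (x / (Nat.lcm m (e ^ 2) : ℕ)) ≤
      ∑ g ∈ m.divisors, if g ∣ e then min 1 (x / m / g / ((e / g : ℕ) : ℝ) ^ 2) else 0 := by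
  have hg : Nat.gcd m e ∈ m.divisors :=
    Nat.mem_divisors.2 ⟨Nat.gcd_dvd_left m e, hm.ne_zero⟩
  refine le_trans (le_of_eq ?_) (Finset.single_le_sum
    (f := fun g : ℕ => if g ∣ e then min 1 (x / m / g / ((e / g : ℕ) : ℝ) ^ 2) else 0)
    (fun g _ => by split_ifs <;> positivity) hg)
  have hg0 : (Nat.gcd m e : ℝ) ≠ 0 := by
    exact_mod_cast Nat.gcd_ne_zero_right he
  have he0 : (e : ℝ) ≠ 0 := by exact_mod_cast he
  simp only [if_pos (Nat.gcd_dvd_right m e)]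
  rw [← div_mul_gcd_div_sq hm, Nat.cast_div (Nat.gcd_dvd_right m e) hg0]
  congr 1
  field_simp

theorem abs_sum_moebius_sq_dvd_sub_le {m : ℕ} (hm : Squarefree m) {x : ℝ} (hx : 0 < x) :
    |∑ n ∈ (Icc 1 ⌊x⌋₊).filter (fun n => m ∣ n), (moebius n : ℝ) ^ 2 -
      x * (6 / Real.pi ^ 2 / psi m)| ≤ 4 * √x * errWeight m := by
  have hm0 : (m : ℝ) ≠ 0 := by exact_mod_cast hm.ne_zero
  have hmpos : (0 : ℝ) < m := by exact_mod_cast Nat.pos_of_ne_zero hm.ne_zero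
  set N := ⌊x⌋₊
  rw [sum_moebius_sq_dvd_eq]
  have hS : HasSum (fun e : ℕ => (moebius e : ℝ) * ((N / Nat.lcm m (e ^ 2) : ℕ) : ℝ))
      (∑ e ∈ Icc 1 N, (moebius e : ℝ) * ((N / Nat.lcm m (e ^ 2) : ℕ) : ℝ)) := by
    refine hasSum_sum_of_ne_finset_zero fun e he => ?_
    rcases Nat.eq_zero_or_pos e with rfl | hpos
    · simp
    · have h1 : N < e := by
        by_contra h
        exact he (mem_Icc.2 ⟨hpos, not_lt.1 h⟩)
      have h2 : e ^ 2 ≤ Nat.lcm m (e ^ 2) :=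
        Nat.le_of_dvd (Nat.lcm_pos (Nat.pos_of_ne_zero hm.ne_zero) (pow_pos hpos 2))
          (Nat.dvd_lcm_right _ _)
      have h3 : e ≤ e ^ 2 := Nat.le_self_pow two_ne_zero e
      rw [Nat.div_eq_of_lt (by lia), Nat.cast_zero, mul_zero]
  have hF := (hasSum_moebius_mul_gcd hm).mul_left (x / m)
  have hval : x / m * (6 / Real.pi ^ 2 * (m / psi m)) = x * (6 / Real.pi ^ 2 / psi m) := by
    field_simp
  rw [hval] at hF
  have hD := hS.sub hF
  have hterm : ∀ e : ℕ, (moebius e : ℝ) * ((N / Nat.lcm m (e ^ 2) : ℕ) : ℝ) -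
      x / m * ((moebius e : ℝ) * (Nat.gcd m e : ℝ) / (e : ℝ) ^ 2) =
      (moebius e : ℝ) * (((N / Nat.lcm m (e ^ 2) : ℕ) : ℝ) - x / (Nat.lcm m (e ^ 2) : ℕ)) := by
    intro e
    rw [← div_mul_gcd_div_sq hm]
    ring
  simp only [hterm] at hD
  refine le_of_tendsto' hD.tendsto_sum_nat.abs fun K => ?_
  calc _ ≤ ∑ e ∈ range K, |(moebius e : ℝ) *
        (((N / Nat.lcm m (e ^ 2) : ℕ) : ℝ) - x / (Nat.lcm m (e ^ 2) : ℕ))| :=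
        Finset.abs_sum_le_sum_abs _ _
    _ ≤ ∑ e ∈ range (K + 1), |(moebius e : ℝ) *
        (((N / Nat.lcm m (e ^ 2) : ℕ) : ℝ) - x / (Nat.lcm m (e ^ 2) : ℕ))| :=
        Finset.sum_le_sum_of_subset_of_nonneg (Finset.range_subset_range.2 K.le_succ)
          fun _ _ _ => abs_nonneg _
    _ = ∑ e ∈ Icc 1 K, |(moebius e : ℝ) *
        (((N / Nat.lcm m (e ^ 2) : ℕ) : ℝ) - x / (Nat.lcm m (e ^ 2) : ℕ))| := by
        rw [Finset.sum_range_eq_add_Ico _ K.succ_pos]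
        simp only [ArithmeticFunction.map_zero, Int.cast_zero, zero_mul, abs_zero, zero_add]
        rfl
    _ ≤ ∑ e ∈ Icc 1 K, ∑ g ∈ m.divisors,
        if g ∣ e then min 1 (x / m / g / ((e / g : ℕ) : ℝ) ^ 2) else 0 := by
        refine Finset.sum_le_sum fun e he => ?_
        refine le_trans ?_ (min_one_div_lcm_le hm (by simp at he; lia) hx.le)
        rw [abs_mul]
        have h1 : |(moebius e : ℝ)| ≤ 1 := by
          exact_mod_cast ArithmeticFunction.abs_moebius_le_one (n := e)
        calc _ ≤ 1 * min 1 (x / (Nat.lcm m (e ^ 2) : ℕ)) :=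
              mul_le_mul h1 (abs_floor_div_sub_div_le hx.le _) (abs_nonneg _) zero_le_one
          _ = _ := one_mul _
    _ = ∑ g ∈ m.divisors, ∑ k ∈ Icc 1 (K / g), min 1 (x / m / g / (k : ℝ) ^ 2) := by
        rw [Finset.sum_comm]
        refine Finset.sum_congr rfl fun g hg => ?_
        have hg0 := Nat.pos_of_mem_divisors hg
        rw [← Finset.sum_filter, sum_filter_dvd_Icc hg0]
        simp only [Nat.mul_div_cancel_left _ hg0]
    _ ≤ ∑ g ∈ m.divisors, 4 * √(x / m / g) := by
        refine Finset.sum_le_sum fun g hg => sum_min_one_div_sq_le ?_ _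
        have : (0 : ℝ) < g := by exact_mod_cast Nat.pos_of_mem_divisors hg
        positivity
    _ = 4 * √x * errWeight m := by
        rw [errWeight_eq_div hm, sqrtProd_eq_sum_divisors hm, Finset.sum_div, Finset.mul_sum]
        refine Finset.sum_congr rfl fun g _ => ?_
        rw [Real.sqrt_div (by positivity), Real.sqrt_div hx.le]
        ring

theorem exists_sum_errWeight_le : ∃ C : ℝ, 0 ≤ C ∧ ∀ n : ℕ,
    ∑ a ∈ Icc 1 n, (if Squarefree a then errWeight a else 0) ≤ C * √(n : ℝ) := by
  have hsum : Summable fun k : ℕ => 1 / (k : ℝ) ^ (3 / 2 : ℝ) :=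
    Real.summable_one_div_nat_rpow.2 (by norm_num)
  refine ⟨2 * ∑' k : ℕ, 1 / (k : ℝ) ^ (3 / 2 : ℝ), by positivity, fun n => ?_⟩
  calc _ ≤ ∑ a ∈ Icc 1 n, ∑ k ∈ Icc 1 n, (if k ∣ a then 1 / √(k : ℝ) * (1 / √(a : ℝ)) else 0) := by
        refine Finset.sum_le_sum fun a ha => ?_
        split_ifs with hsq
        · rw [errWeight_eq_div hsq, sqrtProd_eq_sum_divisors hsq, Finset.sum_div,
            ← Finset.sum_filter]
          have hset : (Icc 1 n).filter (fun k => k ∣ a) = a.divisors := by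
            ext k
            simp only [mem_filter, mem_Icc, Nat.mem_divisors] at ha ⊢
            refine ⟨fun h => ⟨h.2, by lia⟩, fun h => ⟨⟨Nat.pos_of_dvd_of_pos h.1 ha.1, ?_⟩, h.1⟩⟩
            exact (Nat.le_of_dvd ha.1 h.1).trans ha.2
          rw [hset]
          exact le_of_eq (Finset.sum_congr rfl fun k _ => by ring)
        · exact Finset.sum_nonneg fun k _ => by split_ifs <;> positivity
    _ = ∑ k ∈ Icc 1 n, ∑ b ∈ Icc 1 (n / k), 1 / √(k : ℝ) * (1 / √((k * b : ℕ) : ℝ)) := by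
        rw [Finset.sum_comm]
        refine Finset.sum_congr rfl fun k hk => ?_
        rw [← Finset.sum_filter, sum_filter_dvd_Icc (mem_Icc.1 hk).1]
    _ ≤ ∑ k ∈ Icc 1 n, 2 * √(n : ℝ) * (1 / (k : ℝ) ^ (3 / 2 : ℝ)) := by
        refine Finset.sum_le_sum fun k hk => ?_
        have hk0 : (0 : ℝ) < k := by exact_mod_cast (mem_Icc.1 hk).1
        have hpow : (k : ℝ) ^ (3 / 2 : ℝ) = √(k : ℝ) * √(k : ℝ) * √(k : ℝ) := by
          rw [Real.mul_self_sqrt hk0.le, Real.sqrt_eq_rpow, ← Real.rpow_one_add' hk0.le (by norm_num)]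
          norm_num
        calc _ = 1 / (√(k : ℝ) * √(k : ℝ)) * ∑ b ∈ Icc 1 (n / k), 1 / √(b : ℝ) := by
              rw [Finset.mul_sum]
              refine Finset.sum_congr rfl fun b _ => ?_
              rw [Nat.cast_mul, Real.sqrt_mul hk0.le]
              ring
          _ ≤ 1 / (√(k : ℝ) * √(k : ℝ)) * (2 * √((n : ℝ) / k)) := by
              gcongr
              refine (sum_one_div_sqrt_le _).trans ?_
              gcongr
              exact Nat.cast_div_le
          _ = _ := by
              rw [hpow, Real.sqrt_div (Nat.cast_nonneg n)]
              ring
    _ ≤ 2 * √(n : ℝ) * ∑' k : ℕ, 1 / (k : ℝ) ^ (3 / 2 : ℝ) := by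
        rw [← Finset.mul_sum]
        gcongr
        exact hsum.sum_le_tsum _ fun _ _ => by positivity
    _ = _ := by ring

theorem sqrtProd_sq_le {g : ℕ} (hg : Squarefree g) :
    sqrtProd g ^ 2 ≤ 4 ^ 256 * (g : ℝ) ^ (1 / 4 : ℝ) := by
  have h1 : (g : ℝ) ^ (1 / 4 : ℝ) = ∏ p ∈ g.primeFactors, (p : ℝ) ^ (1 / 4 : ℝ) := by
    rw [Real.finsetProd_rpow _ _ (fun p _ => Nat.cast_nonneg p), ← Nat.cast_prod,
      Nat.prod_primeFactors_of_squarefree hg]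
  have hpos : 0 < (g : ℝ) ^ (1 / 4 : ℝ) :=
    Real.rpow_pos_of_pos (by exact_mod_cast Nat.pos_of_ne_zero hg.ne_zero) _
  rw [← div_le_iff₀ hpos, sqrtProd, h1, ← Finset.prod_pow, ← Finset.prod_div_distrib]
  have hfour : ∀ n : ℕ, (1 + 1 / √(n : ℝ)) ^ 2 ≤ 4 := by
    intro n
    have h2 : 1 / √(n : ℝ) ≤ 1 := by
      rcases Nat.eq_zero_or_pos n with rfl | hn
      · simp
      · rw [div_le_one (Real.sqrt_pos.2 (by exact_mod_cast hn)), Real.one_le_sqrt]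
        exact_mod_cast hn
    have h3 : 0 ≤ 1 / √(n : ℝ) := by positivity
    nlinarith
  refine prod_le_pow_of_le (f := fun n : ℕ => (1 + 1 / √(n : ℝ)) ^ 2 / (n : ℝ) ^ (1 / 4 : ℝ))
    (fun n => by positivity) (by norm_num) (fun n => ?_) (fun n hn => ?_) _
  · rcases Nat.eq_zero_or_pos n with rfl | hn
    · simp
    · refine (div_le_self (sq_nonneg _) ?_).trans (hfour n)
      exact Real.one_le_rpow (by exact_mod_cast hn) (by norm_num)
  · have h256 : (4 : ℝ) ≤ (n : ℝ) ^ (1 / 4 : ℝ) := by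
      calc (4 : ℝ) = (256 : ℝ) ^ (1 / 4 : ℝ) := by
            rw [show (256 : ℝ) = 4 ^ (4 : ℝ) by norm_num, ← Real.rpow_mul (by norm_num)]
            norm_num
        _ ≤ _ := Real.rpow_le_rpow (by norm_num) (by exact_mod_cast hn) (by norm_num)
    exact (div_le_one (by linarith)).2 ((hfour n).trans h256)

theorem exists_sum_sqrt_mul_errWeight_sq_div_le : ∃ C : ℝ, 0 ≤ C ∧ ∀ n : ℕ,
    ∑ g ∈ Icc 1 n, √(g : ℝ) * (if Squarefree g then errWeight g else 0) ^ 2 / g ≤ C := by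
  have hsum : Summable fun k : ℕ => 1 / (k : ℝ) ^ (5 / 4 : ℝ) :=
    Real.summable_one_div_nat_rpow.2 (by norm_num)
  refine ⟨4 ^ 256 * ∑' k : ℕ, 1 / (k : ℝ) ^ (5 / 4 : ℝ), by positivity, fun n => ?_⟩
  calc _ ≤ ∑ g ∈ Icc 1 n, 4 ^ 256 * (1 / (g : ℝ) ^ (5 / 4 : ℝ)) := by
        refine Finset.sum_le_sum fun g hg => ?_
        have hg0 : (0 : ℝ) < g := by exact_mod_cast (mem_Icc.1 hg).1
        split_ifs with hsq
        · rw [errWeight_eq_div hsq, div_pow, Real.sq_sqrt hg0.le]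
          calc _ ≤ √(g : ℝ) * (4 ^ 256 * (g : ℝ) ^ (1 / 4 : ℝ) / g) / g := by
                gcongr
                exact sqrtProd_sq_le hsq
            _ = 4 ^ 256 * ((g : ℝ) ^ (1 / 2 : ℝ) * (g : ℝ) ^ (1 / 4 : ℝ) / (g : ℝ) ^ (2 : ℝ)) := by
                rw [Real.sqrt_eq_rpow, Real.rpow_two]
                ring
            _ = _ := by
                rw [← Real.rpow_add hg0, ← Real.rpow_sub hg0, one_div ((g : ℝ) ^ (5 / 4 : ℝ)),
                  ← Real.rpow_neg hg0.le]
                norm_num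
        · rw [zero_pow two_ne_zero, mul_zero, zero_div]
          positivity
    _ ≤ _ := by
        rw [← Finset.mul_sum]
        gcongr
        exact hsum.sum_le_tsum _ fun _ _ => by positivity

theorem primeFactors_lcm_eq_union {a b : ℕ} (ha : a ≠ 0) (hb : b ≠ 0) :
    (Nat.lcm a b).primeFactors = a.primeFactors ∪ b.primeFactors := by
  ext p
  simp only [Finset.mem_union, Nat.mem_primeFactors]
  have h := Nat.lcm_ne_zero ha hb
  constructor
  · rintro ⟨hp, hd, -⟩
    exact (hp.dvd_lcm.1 hd).imp (fun h => ⟨hp, h, ha⟩) fun h => ⟨hp, h, hb⟩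
  · rintro (⟨hp, hd, -⟩ | ⟨hp, hd, -⟩)
    exacts [⟨hp, hp.dvd_lcm.2 (Or.inl hd), h⟩, ⟨hp, hp.dvd_lcm.2 (Or.inr hd), h⟩]

theorem errWeight_lcm_right_le {a b : ℕ} (ha : a ≠ 0) (hb : b ≠ 0) :
    errWeight (Nat.lcm a b) ≤ 2 ^ 4 * errWeight a := by
  have hunion : (Nat.lcm a b).primeFactors = a.primeFactors ∪ (b.primeFactors \ a.primeFactors) := by
    rw [Finset.union_sdiff_self_eq_union, primeFactors_lcm_eq_union ha hb]
  rw [errWeight, hunion, Finset.prod_union Finset.disjoint_sdiff, mul_comm]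
  refine mul_le_mul_of_nonneg_right ?_ (errWeight_nonneg a)
  refine prod_le_pow_of_le (f := fun n : ℕ => 1 / √(n : ℝ) + 1 / (n : ℝ))
    (fun n => by positivity) (by norm_num) (fun n => ?_) (fun n hn => ?_) _
  · rcases Nat.eq_zero_or_pos n with rfl | hn
    · simp
    · have hn1 : (1 : ℝ) ≤ n := by exact_mod_cast hn
      have h1 : 1 / √(n : ℝ) ≤ 1 := (div_le_one (by positivity)).2 (Real.one_le_sqrt.2 hn1)
      have h2 : 1 / (n : ℝ) ≤ 1 := (div_le_one (by positivity)).2 hn1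
      linarith
  · have hn4 : (4 : ℝ) ≤ n := by exact_mod_cast hn
    have h2 : 2 ≤ √(n : ℝ) := Real.le_sqrt_of_sq_le (by linarith)
    have h3 : 1 / √(n : ℝ) ≤ 1 / 2 := one_div_le_one_div_of_le (by norm_num) h2
    have h4 : 1 / (n : ℝ) ≤ 1 / 4 := one_div_le_one_div_of_le (by norm_num) hn4
    linarith

theorem errWeight_lcm_le {d t : ℕ} (hd : Squarefree d) (ht : Squarefree t) :
    errWeight (Nat.lcm d t) ≤ errWeight d * errWeight t * √(Nat.gcd d t : ℝ) := by
  have hmul : errWeight (Nat.lcm d t) * errWeight (Nat.gcd d t) = errWeight d * errWeight t := by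
    simp only [errWeight]
    rw [primeFactors_lcm_eq_union hd.ne_zero ht.ne_zero, Nat.primeFactors_gcd hd.ne_zero ht.ne_zero,
      Finset.prod_union_inter]
  have hg : Squarefree (Nat.gcd d t) := hd.squarefree_of_dvd (Nat.gcd_dvd_left d t)
  have hs : 0 < √(Nat.gcd d t : ℝ) :=
    Real.sqrt_pos.2 (by exact_mod_cast Nat.pos_of_ne_zero hg.ne_zero)
  rw [← hmul, errWeight_eq_div hg, mul_assoc, div_mul_cancel₀ _ hs.ne']
  exact le_mul_of_one_le_right (errWeight_nonneg _) (one_le_sqrtProd _)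

theorem errWeight_mul_of_squarefree {a b : ℕ} (h : Squarefree (a * b)) :
    errWeight (a * b) = errWeight a * errWeight b := by
  have hab := Nat.coprime_of_squarefree_mul h
  rw [errWeight, hab.primeFactors_mul, Finset.prod_union hab.disjoint_primeFactors]
  rfl

theorem exists_sum_sum_errWeight_lcm_le : ∃ C : ℝ, 0 ≤ C ∧ ∀ N : ℕ,
    ∑ d ∈ Icc 1 N, ∑ t ∈ Icc 1 N,
      (if Squarefree d ∧ Squarefree t then errWeight (Nat.lcm d t) else 0) ≤ C * N := by
  obtain ⟨C₁, hC₁, h₁⟩ := exists_sum_errWeight_le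
  obtain ⟨C₂, hC₂, h₂⟩ := exists_sum_sqrt_mul_errWeight_sq_div_le
  refine ⟨C₁ ^ 2 * C₂, by positivity, fun N => ?_⟩
  set u : ℕ → ℝ := fun d => if Squarefree d then errWeight d else 0 with hu
  have hu0 : ∀ d, 0 ≤ u d := fun d => by
    simp only [hu]
    split_ifs
    exacts [errWeight_nonneg d, le_rfl]
  have hmul : ∀ g a, u (g * a) ≤ u g * u a := by
    intro g a
    by_cases h : Squarefree (g * a)
    · simp only [hu]
      rw [if_pos h, if_pos h.of_mul_left, if_pos h.of_mul_right, errWeight_mul_of_squarefree h]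
    · exact (le_of_eq (if_neg h)).trans (mul_nonneg (hu0 g) (hu0 a))
  have hinner : ∀ g ∈ Icc 1 N, ∑ d ∈ (Icc 1 N).filter (fun d => g ∣ d), u d ≤
      u g * (C₁ * √((N : ℝ) / g)) := by
    intro g hg
    rw [sum_filter_dvd_Icc (mem_Icc.1 hg).1]
    calc _ ≤ ∑ a ∈ Icc 1 (N / g), u g * u a := Finset.sum_le_sum fun a _ => hmul g a
      _ ≤ u g * (C₁ * √((N / g : ℕ) : ℝ)) := by
          rw [← Finset.mul_sum]
          exact mul_le_mul_of_nonneg_left (h₁ _) (hu0 g)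
      _ ≤ _ := by
          have := hu0 g
          gcongr
          exact Nat.cast_div_le
  calc _ ≤ ∑ d ∈ Icc 1 N, ∑ t ∈ Icc 1 N, ∑ g ∈ Icc 1 N,
        √(g : ℝ) * ((if g ∣ d then u d else 0) * (if g ∣ t then u t else 0)) := by
        refine Finset.sum_le_sum fun d hd => Finset.sum_le_sum fun t ht => ?_
        have hnn : ∀ g ∈ Icc 1 N,
            0 ≤ √(g : ℝ) * ((if g ∣ d then u d else 0) * (if g ∣ t then u t else 0)) := by
          intro g _
          have := hu0 d
          have := hu0 t
          split_ifs <;> positivity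
        split_ifs with h
        · have hpos := Nat.gcd_pos_of_pos_left t (mem_Icc.1 hd).1
          have hmem : Nat.gcd d t ∈ Icc 1 N := mem_Icc.2
            ⟨hpos, (Nat.gcd_le_left t (mem_Icc.1 hd).1).trans (mem_Icc.1 hd).2⟩
          refine le_trans ?_ (Finset.single_le_sum hnn hmem)
          simp only [if_pos (Nat.gcd_dvd_left d t), if_pos (Nat.gcd_dvd_right d t), hu,
            if_pos h.1, if_pos h.2]
          exact (errWeight_lcm_le h.1 h.2).trans (le_of_eq (mul_comm _ _))
        · exact Finset.sum_nonneg hnn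
    _ = ∑ g ∈ Icc 1 N, √(g : ℝ) * (∑ d ∈ (Icc 1 N).filter (fun d => g ∣ d), u d) ^ 2 := by
        simp_rw [Finset.sum_comm (s := Icc 1 N) (t := Icc 1 N) (f := fun t g => √(g : ℝ) *
          ((if g ∣ _ then u _ else 0) * (if g ∣ t then u t else 0)))]
        rw [Finset.sum_comm]
        refine Finset.sum_congr rfl fun g _ => ?_
        rw [sq, Finset.sum_filter, Finset.sum_mul_sum, Finset.mul_sum]
        exact Finset.sum_congr rfl fun d _ => (Finset.mul_sum _ _ _).symm
    _ ≤ ∑ g ∈ Icc 1 N, √(g : ℝ) * (u g * (C₁ * √((N : ℝ) / g))) ^ 2 := by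
        refine Finset.sum_le_sum fun g hg => ?_
        have := Finset.sum_nonneg fun d (_ : d ∈ (Icc 1 N).filter (fun d => g ∣ d)) => hu0 d
        gcongr
        exact hinner g hg
    _ = C₁ ^ 2 * N * ∑ g ∈ Icc 1 N, √(g : ℝ) * u g ^ 2 / g := by
        rw [Finset.mul_sum]
        refine Finset.sum_congr rfl fun g _ => ?_
        rw [mul_pow, mul_pow, Real.sq_sqrt (by positivity)]
        ring
    _ ≤ C₁ ^ 2 * N * C₂ := by
        gcongr
        exact h₂ N
    _ = _ := by ring

theorem mobM_sq_eq {n : ℕ} (hn : n ≠ 0) {z : ℝ} (hz : 0 ≤ z) :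
    (mobM n z : ℝ) ^ 2 = ∑ d ∈ Icc 1 ⌊z⌋₊, ∑ t ∈ Icc 1 ⌊z⌋₊,
      if d ∣ n ∧ t ∣ n then (moebius d : ℝ) * (moebius t : ℝ) else 0 := by
  have hset : n.divisors.filter (fun d : ℕ => (d : ℝ) ≤ z) =
      (Icc 1 ⌊z⌋₊).filter (fun d => d ∣ n) := by
    ext d
    simp only [mem_filter, mem_Icc, Nat.mem_divisors, Nat.le_floor_iff hz]
    exact ⟨fun h => ⟨⟨Nat.pos_of_dvd_of_pos h.1.1 (Nat.pos_of_ne_zero hn), h.2⟩, h.1.1⟩,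
      fun h => ⟨⟨h.2, hn⟩, h.1.2⟩⟩
  rw [mobM, hset, Finset.sum_filter, Int.cast_sum, sq, Finset.sum_mul_sum]
  refine Finset.sum_congr rfl fun d _ => Finset.sum_congr rfl fun t _ => ?_
  split_ifs <;> simp_all

theorem sum_moebius_sq_mul_mobM_sq_eq (N h : ℕ) {z : ℝ} (hz : 0 ≤ z) :
    ∑ n ∈ (Icc 1 N).filter (fun n => h ∣ n), (moebius n : ℝ) ^ 2 * (mobM n z : ℝ) ^ 2 =
      ∑ d ∈ Icc 1 ⌊z⌋₊, ∑ t ∈ Icc 1 ⌊z⌋₊, (moebius d : ℝ) * (moebius t : ℝ) *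
        ∑ n ∈ (Icc 1 N).filter (fun n => Nat.lcm (Nat.lcm d t) h ∣ n), (moebius n : ℝ) ^ 2 := by
  calc _ = ∑ n ∈ (Icc 1 N).filter (fun n => h ∣ n), ∑ d ∈ Icc 1 ⌊z⌋₊, ∑ t ∈ Icc 1 ⌊z⌋₊,
        if d ∣ n ∧ t ∣ n then (moebius d : ℝ) * (moebius t : ℝ) * (moebius n : ℝ) ^ 2 else 0 := by
        refine Finset.sum_congr rfl fun n hn => ?_
        simp only [mem_filter, mem_Icc] at hn
        rw [mobM_sq_eq (by lia) hz, Finset.mul_sum]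
        refine Finset.sum_congr rfl fun d _ => ?_
        rw [Finset.mul_sum]
        refine Finset.sum_congr rfl fun t _ => ?_
        split_ifs <;> ring
    _ = _ := by
        rw [Finset.sum_comm]
        refine Finset.sum_congr rfl fun d _ => ?_
        rw [Finset.sum_comm]
        refine Finset.sum_congr rfl fun t _ => ?_
        rw [← Finset.sum_filter, Finset.filter_filter, Finset.mul_sum]
        refine Finset.sum_congr (Finset.filter_congr fun n _ => ?_) fun _ _ => rfl
        rw [Nat.lcm_dvd_iff, Nat.lcm_dvd_iff, and_comm]

theorem stmt15 :
    ∃ C > (0 : ℝ), ∀ h : ℕ, 1 ≤ h → Squarefree h → ∀ x z : ℝ, 1 ≤ x → 1 ≤ z →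
      |(∑ n ∈ (Finset.Icc 1 ⌊x⌋₊).filter (fun n : ℕ => h ∣ n),
          ((ArithmeticFunction.moebius n : ℝ)) ^ 2 * ((mobM n z : ℝ)) ^ 2) - x * T z h| ≤
        C * z * Real.sqrt x := by
  obtain ⟨C, hC, hbound⟩ := exists_sum_sum_errWeight_lcm_le
  refine ⟨64 * C + 1, by positivity, fun h _ hsq x z hx hz => ?_⟩
  have hz0 : 0 ≤ z := zero_le_one.trans hz
  have hx0 : 0 < x := zero_lt_one.trans_le hx
  rw [sum_moebius_sq_mul_mobM_sq_eq _ _ hz0, T, Finset.mul_sum, Finset.mul_sum,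
    ← Finset.sum_sub_distrib]
  have hterm : ∀ d t : ℕ, |(moebius d : ℝ) * (moebius t : ℝ) *
      (∑ n ∈ (Icc 1 ⌊x⌋₊).filter (fun n => Nat.lcm (Nat.lcm d t) h ∣ n), (moebius n : ℝ) ^ 2 -
        x * (6 / Real.pi ^ 2 / psi (Nat.lcm (Nat.lcm d t) h)))| ≤
      64 * √x * (if Squarefree d ∧ Squarefree t then errWeight (Nat.lcm d t) else 0) := by
    intro d t
    split_ifs with hdt
    · have hl := squarefree_lcm hdt.1 hdt.2
      have habs : ∀ k : ℕ, |(moebius k : ℝ)| ≤ 1 := fun k => by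
        exact_mod_cast ArithmeticFunction.abs_moebius_le_one (n := k)
      rw [abs_mul, abs_mul]
      calc _ ≤ 1 * 1 * (4 * √x * errWeight (Nat.lcm (Nat.lcm d t) h)) := by
            gcongr
            · exact habs d
            · exact habs t
            · exact abs_sum_moebius_sq_dvd_sub_le (squarefree_lcm hl hsq) hx0
        _ ≤ 1 * 1 * (4 * √x * (2 ^ 4 * errWeight (Nat.lcm d t))) := by
            gcongr
            exact errWeight_lcm_right_le hl.ne_zero hsq.ne_zero
        _ = _ := by ring
    · have hzero : (moebius d : ℝ) * (moebius t : ℝ) = 0 := by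
        rcases not_and_or.1 hdt with h0 | h0 <;>
          simp [ArithmeticFunction.moebius_eq_zero_of_not_squarefree h0]
      rw [hzero, zero_mul, abs_zero, mul_zero]
  calc _ ≤ ∑ d ∈ Icc 1 ⌊z⌋₊, ∑ t ∈ Icc 1 ⌊z⌋₊,
        64 * √x * (if Squarefree d ∧ Squarefree t then errWeight (Nat.lcm d t) else 0) := by
        refine (Finset.abs_sum_le_sum_abs _ _).trans (Finset.sum_le_sum fun d _ => ?_)
        rw [Finset.mul_sum, Finset.mul_sum, ← Finset.sum_sub_distrib]
        refine (Finset.abs_sum_le_sum_abs _ _).trans (Finset.sum_le_sum fun t _ => ?_)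
        refine le_trans (le_of_eq ?_) (hterm d t)
        congr 1
        ring
    _ ≤ 64 * √x * (C * ⌊z⌋₊) := by
        simp_rw [← Finset.mul_sum]
        gcongr
        exact hbound _
    _ ≤ 64 * √x * (C * z) := by
        gcongr
        exact Nat.floor_le hz0
    _ ≤ (64 * C + 1) * z * √x := by
        have : 0 ≤ z * √x := by positivity
        linarith
end

section
/- For every integer n ≥ 1 and every real σ > 0, one has the Plancherel identity ∫_0^∞ M(n, e^u)² e^{−2σu} du = (1/2π) ∫_ℝ f(n; σ + iτ) dτ/(σ² + τ²), where f(n; s) := ∏_{p | n} |1 − p^{−s}|². -/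
open Finset MeasureTheory Filter

theorem integrable_inv_sq_add_sq {σ : ℝ} (hσ : 0 < σ) :
    Integrable fun τ : ℝ => (σ ^ 2 + τ ^ 2)⁻¹ := by
  refine ((integrable_inv_one_add_sq.comp_div hσ.ne').const_mul (σ ^ 2)⁻¹).congr
    (Eventually.of_forall fun τ => ?_)
  simp only
  rw [← mul_inv]
  congr 1
  field_simp

theorem integrable_exp_neg_mul_abs {c : ℝ} (hc : 0 < c) :
    Integrable fun x : ℝ => (Real.exp (-(c * |x|)) : ℂ) := by
  refine Integrable.ofReal (f := fun x : ℝ => Real.exp (-(c * |x|))) ?_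
  rw [← integrableOn_univ, ← Set.Iic_union_Ioi (a := (0 : ℝ))]
  refine IntegrableOn.union ?_ ?_
  · refine (integrableOn_exp_mul_Iic hc 0).congr_fun (fun x hx => ?_) measurableSet_Iic
    simp [abs_of_nonpos (Set.mem_Iic.1 hx)]
  · refine (integrableOn_exp_mul_Ioi (neg_lt_zero.2 hc) 0).congr_fun (fun x hx => ?_)
      measurableSet_Ioi
    simp [abs_of_pos (Set.mem_Ioi.1 hx)]

open FourierTransform in
theorem fourier_exp_neg_mul_abs {σ : ℝ} (hσ : 0 < σ) (w : ℝ) :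
    𝓕 (fun x : ℝ => (Real.exp (-(2 * Real.pi * σ * |x|)) : ℂ)) w =
      ((σ / Real.pi * (σ ^ 2 + w ^ 2)⁻¹ : ℝ) : ℂ) := by
  have hc : 0 < 2 * Real.pi * σ := by positivity
  rw [Real.fourier_real_eq_integral_exp_smul]
  have hneg : Set.EqOn (fun v : ℝ => Complex.exp (↑(-2 * Real.pi * v * w) * Complex.I) •
      (Real.exp (-(2 * Real.pi * σ * |v|)) : ℂ))
      (fun v : ℝ => Complex.exp ((2 * Real.pi * (σ - w * Complex.I)) * v)) (Set.Iic 0) := by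
    intro v hv
    simp only [smul_eq_mul, Complex.ofReal_exp, ← Complex.exp_add,
      abs_of_nonpos (Set.mem_Iic.1 hv)]
    congr 1
    push_cast
    ring
  have hpos : Set.EqOn (fun v : ℝ => Complex.exp (↑(-2 * Real.pi * v * w) * Complex.I) •
      (Real.exp (-(2 * Real.pi * σ * |v|)) : ℂ))
      (fun v : ℝ => Complex.exp ((-(2 * Real.pi * (σ + w * Complex.I))) * v)) (Set.Ioi 0) := by
    intro v hv
    simp only [smul_eq_mul, Complex.ofReal_exp, ← Complex.exp_add,
      abs_of_pos (Set.mem_Ioi.1 hv)]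
    congr 1
    push_cast
    ring
  have h1 : 0 < (2 * Real.pi * (σ - w * Complex.I) : ℂ).re := by simpa using hc
  have h2 : (-(2 * Real.pi * (σ + w * Complex.I)) : ℂ).re < 0 := by simpa using hc
  have hm : (σ - w * Complex.I : ℂ) ≠ 0 := fun h => by
    simpa [hσ.ne'] using congrArg Complex.re h
  have hp : (σ + w * Complex.I : ℂ) ≠ 0 := fun h => by
    simpa [hσ.ne'] using congrArg Complex.re h
  have hprod : ((σ : ℂ) ^ 2 + (w : ℂ) ^ 2) = (σ - w * Complex.I) * (σ + w * Complex.I) := by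
    linear_combination (w : ℂ) ^ 2 * Complex.I_sq
  have hπ : (Real.pi : ℂ) ≠ 0 := by exact_mod_cast Real.pi_ne_zero
  rw [← intervalIntegral.integral_Iic_add_Ioi (b := 0)
      ((integrableOn_exp_mul_complex_Iic h1 0).congr_fun hneg.symm measurableSet_Iic)
      ((integrableOn_exp_mul_complex_Ioi h2 0).congr_fun hpos.symm measurableSet_Ioi),
    setIntegral_congr_fun measurableSet_Iic hneg, setIntegral_congr_fun measurableSet_Ioi hpos,
    integral_exp_mul_complex_Iic h1, integral_exp_mul_complex_Ioi h2]
  push_cast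
  rw [hprod]
  simp only [mul_zero, Complex.exp_zero]
  field_simp
  ring

open FourierTransform in
/-- The Fourier transform of the Lorentzian `1 / (σ² + τ²)`. -/
theorem integral_exp_mul_I_div_sq_add_sq {σ : ℝ} (hσ : 0 < σ) (a : ℝ) :
    ∫ τ : ℝ, Complex.exp ((a * τ : ℝ) * Complex.I) * ((σ ^ 2 + τ ^ 2)⁻¹ : ℝ) =
      ((Real.pi / σ * Real.exp (-(σ * |a|)) : ℝ) : ℂ) := by
  have hF : 𝓕 (fun x : ℝ => (Real.exp (-(2 * Real.pi * σ * |x|)) : ℂ)) =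
      fun w : ℝ => ((σ / Real.pi * (σ ^ 2 + w ^ 2)⁻¹ : ℝ) : ℂ) :=
    funext (fourier_exp_neg_mul_abs hσ)
  have hcont : Continuous fun x : ℝ => (Real.exp (-(2 * Real.pi * σ * |x|)) : ℂ) := by
    fun_prop
  have hint : Integrable (𝓕 fun x : ℝ => (Real.exp (-(2 * Real.pi * σ * |x|)) : ℂ)) := by
    rw [hF]
    exact ((integrable_inv_sq_add_sq hσ).const_mul _).ofReal
  have key := congrFun (hcont.fourierInv_fourier_eq
    (integrable_exp_neg_mul_abs (c := 2 * Real.pi * σ) (by positivity)) hint) (a / (2 * Real.pi))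
  rw [hF, Real.fourierInv_eq'] at key
  have hπ : (Real.pi : ℂ) ≠ 0 := by exact_mod_cast Real.pi_ne_zero
  have hσ' : (σ : ℂ) ≠ 0 := by exact_mod_cast hσ.ne'
  have hlhs : ∀ τ : ℝ, Complex.exp (((2 * Real.pi * inner ℝ τ (a / (2 * Real.pi)) : ℝ) : ℂ) *
      Complex.I) • ((σ / Real.pi * (σ ^ 2 + τ ^ 2)⁻¹ : ℝ) : ℂ) =
      (σ / Real.pi : ℂ) *
        (Complex.exp ((a * τ : ℝ) * Complex.I) * ((σ ^ 2 + τ ^ 2)⁻¹ : ℝ)) := by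
    intro τ
    have : 2 * Real.pi * inner ℝ τ (a / (2 * Real.pi)) = a * τ := by
      simp only [RCLike.inner_apply, conj_trivial]
      field_simp [Real.pi_ne_zero]
    rw [this]
    push_cast
    simp only [smul_eq_mul]
    ring
  have hrhs : 2 * Real.pi * σ * |a / (2 * Real.pi)| = σ * |a| := by
    rw [abs_div, abs_of_pos Real.two_pi_pos]
    field_simp [Real.pi_ne_zero]
  simp_rw [hlhs] at key
  rw [integral_const_mul, hrhs] at key
  have hcancel : (Real.pi / σ : ℂ) * (σ / Real.pi) = 1 := by field_simp
  rw [Complex.ofReal_mul, ← key, Complex.ofReal_div, ← mul_assoc, hcancel, one_mul]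

/-- `∏_{p ∣ n} (1 - p^{-s}) = ∑_{d ∣ n} μ(d) d^{-s}`. -/
theorem prod_primeFactors_one_sub_cpow {n : ℕ} (hn : n ≠ 0) {s : ℂ} (hs : s ≠ 0) :
    ∏ p ∈ n.primeFactors, (1 - (p : ℂ) ^ (-s)) =
      ∑ d ∈ n.divisors, (ArithmeticFunction.moebius d : ℂ) * (d : ℂ) ^ (-s) := by
  let g : ArithmeticFunction ℂ :=
    ⟨fun d => (d : ℂ) ^ (-s), by simp [Complex.zero_cpow (neg_ne_zero.2 hs)]⟩
  have hg : g.IsMultiplicative := by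
    refine ⟨by simp [g], fun {a b} _ => ?_⟩
    simp [g, Complex.natCast_mul_natCast_cpow]
  have h := hg.prodPrimeFactors_one_sub_of_squarefree g
    (UniqueFactorizationMonoid.squarefree_radical (a := n))
  rw [Nat.primeFactors_radical] at h
  refine h.trans (Finset.sum_subset (Nat.divisors_subset_of_dvd hn
    UniqueFactorizationMonoid.radical_dvd_self) fun d hd hd' => ?_)
  rw [ArithmeticFunction.moebius_eq_zero_of_not_squarefree, Int.cast_zero, zero_mul]
  intro hsq
  exact hd' (Nat.mem_divisors.2 ⟨(UniqueFactorizationMonoid.dvd_radical_iff hsq.isRadical hn).2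
    (Nat.dvd_of_mem_divisors hd), UniqueFactorizationMonoid.radical_ne_zero⟩)

theorem fC_eq_sum {n : ℕ} (hn : n ≠ 0) {σ : ℝ} (hσ : 0 < σ) (τ : ℝ) :
    (fC n ((σ : ℂ) + (τ : ℂ) * Complex.I) : ℂ) =
      ∑ d ∈ n.divisors, ∑ e ∈ n.divisors,
        ((ArithmeticFunction.moebius d * ArithmeticFunction.moebius e *
          Real.exp (-(σ * (Real.log d + Real.log e))) : ℝ) : ℂ) *
          Complex.exp (((Real.log e - Real.log d) * τ : ℝ) * Complex.I) := by
  have hs : ((σ : ℂ) + (τ : ℂ) * Complex.I) ≠ 0 := fun h => by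
    simpa [hσ.ne'] using congrArg Complex.re h
  rw [fC, Finset.prod_pow, ← norm_prod, prod_primeFactors_one_sub_cpow hn hs, Complex.ofReal_pow,
    ← Complex.mul_conj', map_sum, Finset.sum_mul_sum]
  have hcpow : ∀ d ∈ n.divisors, (d : ℂ) ^ (-((σ : ℂ) + (τ : ℂ) * Complex.I)) =
      Complex.exp ((Real.log d : ℂ) * (-((σ : ℂ) + (τ : ℂ) * Complex.I))) := fun d hd => by
    rw [Complex.cpow_def_of_ne_zero (by exact_mod_cast (Nat.pos_of_mem_divisors hd).ne'),
      Complex.natCast_log]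
  refine Finset.sum_congr rfl fun d hd => Finset.sum_congr rfl fun e he => ?_
  rw [hcpow d hd, hcpow e he, map_mul, ← Complex.exp_conj]
  simp only [map_mul, map_neg, map_add, Complex.conj_ofReal, Complex.conj_I, map_intCast,
    Complex.ofReal_mul, Complex.ofReal_intCast, Complex.ofReal_exp]
  rw [mul_mul_mul_comm, ← Complex.exp_add, mul_assoc (_ * _) (Complex.exp _), ← Complex.exp_add]
  congr 2
  push_cast
  ring

theorem integral_fC_div_sq_add_sq {n : ℕ} (hn : n ≠ 0) {σ : ℝ} (hσ : 0 < σ) :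
    ∫ τ : ℝ, fC n ((σ : ℂ) + (τ : ℂ) * Complex.I) / (σ ^ 2 + τ ^ 2) =
      ∑ d ∈ n.divisors, ∑ e ∈ n.divisors,
        (ArithmeticFunction.moebius d * ArithmeticFunction.moebius e *
          Real.exp (-(σ * (Real.log d + Real.log e)))) *
          (Real.pi / σ * Real.exp (-(σ * |Real.log e - Real.log d|))) := by
  have hint : ∀ c a : ℝ, Integrable fun τ : ℝ =>
      (c : ℂ) * (Complex.exp ((a * τ : ℝ) * Complex.I) * ((σ ^ 2 + τ ^ 2)⁻¹ : ℝ)) := by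
    intro c a
    refine ((integrable_inv_sq_add_sq hσ).ofReal.bdd_mul (c := 1) ?_ ?_).const_mul _
    · exact (by fun_prop : Continuous fun τ : ℝ =>
        Complex.exp ((a * τ : ℝ) * Complex.I)).aestronglyMeasurable
    · exact Eventually.of_forall fun τ => (Complex.norm_exp_ofReal_mul_I _).le
  rw [← Complex.ofReal_inj, ← integral_complex_ofReal]
  have hexp : ∀ τ : ℝ, ((fC n ((σ : ℂ) + (τ : ℂ) * Complex.I) / (σ ^ 2 + τ ^ 2) : ℝ) : ℂ) =
      ∑ d ∈ n.divisors, ∑ e ∈ n.divisors,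
        ((ArithmeticFunction.moebius d * ArithmeticFunction.moebius e *
          Real.exp (-(σ * (Real.log d + Real.log e))) : ℝ) : ℂ) *
          (Complex.exp (((Real.log e - Real.log d) * τ : ℝ) * Complex.I) *
            ((σ ^ 2 + τ ^ 2)⁻¹ : ℝ)) := by
    intro τ
    rw [div_eq_mul_inv, Complex.ofReal_mul, fC_eq_sum hn hσ]
    simp only [Finset.sum_mul, mul_assoc]
  refine (integral_congr_ae (Eventually.of_forall hexp)).trans ?_
  rw [integral_finsetSum _ fun d _ => integrable_finsetSum _ fun e _ => hint _ _,
    Complex.ofReal_sum]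
  refine Finset.sum_congr rfl fun d _ => ?_
  rw [integral_finsetSum _ fun e _ => hint _ _, Complex.ofReal_sum]
  refine Finset.sum_congr rfl fun e _ => ?_
  rw [integral_const_mul, integral_exp_mul_I_div_sq_add_sq hσ, ← Complex.ofReal_mul]

theorem mobM_exp_sq (n : ℕ) (u : ℝ) :
    ((mobM n (Real.exp u) : ℝ)) ^ 2 =
      ∑ d ∈ n.divisors, ∑ e ∈ n.divisors,
        (ArithmeticFunction.moebius d * ArithmeticFunction.moebius e : ℝ) *
          (Set.Ici (max (Real.log d) (Real.log e))).indicator 1 u := by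
  rw [mobM, Finset.sum_filter, sq, Int.cast_sum, Finset.sum_mul_sum]
  refine Finset.sum_congr rfl fun d hd => Finset.sum_congr rfl fun e he => ?_
  have hd' : (0 : ℝ) < d := by exact_mod_cast Nat.pos_of_mem_divisors hd
  have he' : (0 : ℝ) < e := by exact_mod_cast Nat.pos_of_mem_divisors he
  simp only [← Real.log_le_iff_le_exp hd', ← Real.log_le_iff_le_exp he', Set.indicator_apply,
    Set.mem_Ici, max_le_iff]
  split_ifs <;> simp_all

theorem integral_mobM_sq (n : ℕ) {σ : ℝ} (hσ : 0 < σ) :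
    ∫ u in Set.Ioi (0 : ℝ), ((mobM n (Real.exp u) : ℝ)) ^ 2 * Real.exp (-(2 * σ * u)) =
      ∑ d ∈ n.divisors, ∑ e ∈ n.divisors,
        (ArithmeticFunction.moebius d * ArithmeticFunction.moebius e : ℝ) *
          (Real.exp (-(2 * σ * max (Real.log d) (Real.log e))) / (2 * σ)) := by
  have hneg : -(2 * σ) < 0 := by linarith
  have hion : ∀ c : ℝ, IntegrableOn (fun u : ℝ => Real.exp (-(2 * σ) * u)) (Set.Ici c) := fun c =>
    (integrableOn_Ici_iff_integrableOn_Ioi).2 (integrableOn_exp_mul_Ioi hneg c)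
  have hint : ∀ c m : ℝ, IntegrableOn (fun u : ℝ =>
      c * (Set.Ici m).indicator (fun u => Real.exp (-(2 * σ) * u)) u) (Set.Ici 0) := fun c m =>
    ((hion 0).indicator measurableSet_Ici).const_mul c
  have hexp : ∀ u : ℝ, ((mobM n (Real.exp u) : ℝ)) ^ 2 * Real.exp (-(2 * σ * u)) =
      ∑ d ∈ n.divisors, ∑ e ∈ n.divisors,
        (ArithmeticFunction.moebius d * ArithmeticFunction.moebius e : ℝ) *
          (Set.Ici (max (Real.log d) (Real.log e))).indicator
            (fun u => Real.exp (-(2 * σ) * u)) u := by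
    intro u
    simp only [mobM_exp_sq, Finset.sum_mul, Set.indicator_apply, mul_assoc, ite_mul,
      Pi.one_apply, one_mul, zero_mul, neg_mul]
  simp_rw [hexp]
  rw [← integral_Ici_eq_integral_Ioi,
    integral_finsetSum _ fun d _ => integrable_finsetSum _ fun e _ => hint _ _]
  refine Finset.sum_congr rfl fun d hd => ?_
  rw [integral_finsetSum _ fun e _ => hint _ _]
  refine Finset.sum_congr rfl fun e _ => ?_
  have hmax : 0 ≤ max (Real.log d) (Real.log e) := le_max_of_le_left (Real.log_natCast_nonneg d)
  rw [integral_const_mul, setIntegral_indicator measurableSet_Ici, Set.Ici_inter_Ici,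
    sup_eq_right.2 hmax, integral_Ici_eq_integral_Ioi, integral_exp_mul_Ioi hneg, neg_div_neg_eq,
    neg_mul]

theorem stmt16 :
    ∀ n : ℕ, 1 ≤ n → ∀ σ : ℝ, 0 < σ →
      ∫ u in Set.Ioi (0 : ℝ), ((mobM n (Real.exp u) : ℝ)) ^ 2 * Real.exp (-(2 * σ * u)) =
        (1 / (2 * Real.pi)) *
          ∫ τ : ℝ, fC n ((σ : ℂ) + (τ : ℂ) * Complex.I) / (σ ^ 2 + τ ^ 2) := by
  intro n hn σ hσ
  rw [integral_mobM_sq n hσ, integral_fC_div_sq_add_sq (Nat.one_le_iff_ne_zero.1 hn) hσ,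
    Finset.mul_sum]
  refine Finset.sum_congr rfl fun d _ => ?_
  rw [Finset.mul_sum]
  refine Finset.sum_congr rfl fun e _ => ?_
  have hexp : Real.exp (-(2 * σ * max (Real.log d) (Real.log e))) =
      Real.exp (-(σ * (Real.log d + Real.log e))) *
        Real.exp (-(σ * |Real.log e - Real.log d|)) := by
    have hmax := max_add_min (Real.log d) (Real.log e)
    have habs := max_sub_min_eq_abs (Real.log d) (Real.log e)
    rw [← Real.exp_add]
    congr 1
    linear_combination (-σ) * hmax - σ * habs
  rw [hexp]
  field_simp [Real.pi_ne_zero]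
end
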